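/- Under the Riccati system c_j' = c_{j+1} − (u₀/c₀) Σ_{i=0}^j c_i c_{j−i}, the bilinear relations (H^0_{n+1})' H^1_n − H^0_{n+1} (H^1_n)' = H^0_n H^1_{n+1} − u₀ H^0_{n+1} H^1_n and H^0_n (H^1_n)' − (H^0_n)' H^1_n = H^0_{n+1} H^1_{n-1} − u₀ H^0_n H^1_n hold for all n ≥ 1. -/

import Mathlib

/-- Time-dependent Hankel determinant `H^m_n(t) = det(c_{i+j+m}(t))`. -/
noncomputable def Hf (c : ℕ → ℝ → ℝ) (m n : ℕ) (t : ℝ) : ℝ :=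
  (Matrix.of fun i j : Fin n => c (i.val + j.val + m) t).det

/-- `G^m_n(t)`: the Hankel determinant `H^m_n(t)` with its last row shifted
forward by one index; by convention `G^m_0 = 0`. -/
noncomputable def Gf (c : ℕ → ℝ → ℝ) (m n : ℕ) (t : ℝ) : ℝ :=
  if n = 0 then 0 else
  (Matrix.of fun i j : Fin n =>
    if i.val = n - 1 then c (m + n + j.val) t else c (i.val + j.val + m) t).det

namespace Matrix

variable {R : Type*} [CommRing R]

/-- The sum of the determinants in which one row of `M` at a time is replaced by that of `W`. -/
theorem sum_det_updateRow {ι : Type*} [Fintype ι] [DecidableEq ι] (M W : Matrix ι ι R) :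
    ∑ k, (M.updateRow k (W k)).det = (W * M.adjugate).trace := by
  simp only [trace, diag_apply, mul_apply]
  refine Finset.sum_congr rfl fun k _ => ?_
  rw [← cramer_transpose_apply, cramer_eq_adjugate_mulVec, ← adjugate_transpose]
  simp only [mulVec, dotProduct, transpose_apply, mul_comm]

/-- A `2 × 2` minor of the cofactor matrix, with arbitrary replacement rows. -/
theorem det_mul_det_updateRow_updateRow {ι : Type*} [Fintype ι] [DecidableEq ι]
    (M : Matrix ι ι R) {i j : ι} (hij : i ≠ j) (v w : ι → R) :
    M.det * ((M.updateRow i v).updateRow j w).det =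
      (M.updateRow i v).det * (M.updateRow j w).det -
        (M.updateRow j v).det * (M.updateRow i w).det := by
  have hv : M.det • v = ∑ k, (M.updateRow k v).det • M k := by
    rw [← det_transpose, ← mulVec_cramer]
    ext l
    simp [mulVec, dotProduct, cramer_transpose_apply, mul_comm]
  have hlin : ∀ (u : ι → R), ((M.updateRow j w).updateRow i u).det =
      cramer (M.updateRow j w)ᵀ u i := fun u => (cramer_transpose_apply _ _ _).symm
  have hself : ((M.updateRow j w).updateRow i (M i)).det = (M.updateRow j w).det := by
    congr 1
    rw [updateRow_comm _ hij.symm, updateRow_eq_self]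
  have hswap : ((M.updateRow j w).updateRow i (M j)).det = -(M.updateRow i w).det := by
    have h : ((M.updateRow j w).updateRow i (M j)).submatrix (Equiv.swap i j) id =
        M.updateRow i w := by
      ext k l
      rcases eq_or_ne k i with rfl | hki
      · simp [updateRow_ne hij.symm]
      rcases eq_or_ne k j with rfl | hkj
      · simp [updateRow_ne hki]
      · simp [Equiv.swap_apply_of_ne_of_ne hki hkj, updateRow_ne hki, updateRow_ne hkj]
    rw [← h, det_permute, Equiv.Perm.sign_swap hij]
    simp
  have hzero : ∀ k, k ≠ i → k ≠ j → ((M.updateRow j w).updateRow i (M k)).det = 0 := by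
    intro k hki hkj
    refine det_zero_of_row_eq hki ?_
    rw [updateRow_ne hki, updateRow_ne hkj, updateRow_self]
  rw [updateRow_comm _ hij, ← det_updateRow_smul, hv, hlin, map_sum, Finset.sum_apply,
    Finset.sum_eq_add i j hij]
  · simp only [map_smul, Pi.smul_apply]
    simp only [← hlin, hself, hswap, smul_eq_mul]
    ring
  · rintro k - ⟨hki, hkj⟩
    rw [map_smul, Pi.smul_apply, ← hlin, hzero k hki hkj, smul_zero]
  · simp
  · simp

theorem det_cons_eq_det_snoc {n : ℕ} (v : Fin (n + 1) → R) (A : Fin n → Fin (n + 1) → R) :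
    (of (Fin.cons v A : Fin (n + 1) → Fin (n + 1) → R)).det =
      (-1) ^ n * (of (Fin.snoc A v : Fin (n + 1) → Fin (n + 1) → R)).det := by
  have h : of (Fin.snoc A v : Fin (n + 1) → Fin (n + 1) → R) =
      (of (Fin.cons v A : Fin (n + 1) → Fin (n + 1) → R)).submatrix (finRotate (n + 1)) id := by
    ext i j
    rw [Fin.snoc_eq_cons_rotate]
    rfl
  rw [h, det_permute, sign_finRotate, ← mul_assoc]
  simp [← mul_pow]

theorem det_updateRow_single {n : ℕ} (A : Matrix (Fin (n + 1)) (Fin (n + 1)) R)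
    (i j : Fin (n + 1)) :
    (A.updateRow i (Pi.single j 1)).det =
      (-1) ^ (i + j : ℕ) * (A.submatrix i.succAbove j.succAbove).det := by
  rw [← adjugate_apply, adjugate_fin_succ_eq_det_submatrix]

end Matrix

theorem HasDerivAt.matrix_det {ι : Type*} [Fintype ι] [DecidableEq ι]
    {M : ℝ → Matrix ι ι ℝ} {M' : Matrix ι ι ℝ} {t : ℝ}
    (h : ∀ i j, HasDerivAt (fun s => M s i j) (M' i j) t) :
    HasDerivAt (fun s => (M s).det) (M' * (M t).adjugate).trace t := by
  let D : ContinuousMultilinearMap ℝ (fun _ : ι => ι → ℝ) ℝ :=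
    ⟨(Matrix.detRowAlternating : (ι → ℝ) [⋀^ι]→ₗ[ℝ] ℝ).toMultilinearMap,
      (continuous_id.matrix_det : Continuous fun M : Matrix ι ι ℝ => M.det)⟩
  have hM : HasDerivAt (fun s => (M s : ι → ι → ℝ)) M' t :=
    hasDerivAt_pi.2 fun i => hasDerivAt_pi.2 fun j => h i j
  rw [← Matrix.sum_det_updateRow]
  exact ((D.hasFDerivAt (M t)).comp_hasDerivAt t hM).congr_deriv (D.linearDeriv_apply (M t) M')

theorem sum_fin_ite_le {R : Type*} [AddCommMonoid R] {N i : ℕ} (hi : i < N) (f : ℕ → R) :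
    ∑ k : Fin N, (if k.val ≤ i then f k else 0) = ∑ k ∈ Finset.range (i + 1), f k := by
  rw [Fin.sum_univ_eq_sum_range (fun k => if k ≤ i then f k else 0), ← Finset.sum_filter]
  congr 1
  ext k
  simp only [Finset.mem_filter, Finset.mem_range]
  omega

theorem sum_convolution_split {R : Type*} [CommRing R] (x : ℕ → R) {m : ℕ} (hm : m ≤ 1)
    (i j : ℕ) :
    ∑ a ∈ Finset.range (i + j + m + 1), x a * x (i + j + m - a) =
      ∑ k ∈ Finset.range (i + 1), x (i - k) * x (k + j + m) +
        ∑ k ∈ Finset.range (j + 1), x (i + k + m) * (if 1 ≤ k + m then x (j - k) else 0) := by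
  rw [show i + j + m + 1 = (i + 1) + (j + m) by ring, Finset.sum_range_add]
  congr 1
  · rw [← Finset.sum_range_reflect]
    refine Finset.sum_congr rfl fun k hk => ?_
    have := Finset.mem_range.1 hk
    congr 2
    omega
  · interval_cases m
    · rw [Finset.sum_range_succ']
      simp only [add_zero]
      rw [if_neg (by omega), mul_zero, add_zero]
      refine Finset.sum_congr rfl fun k hk => ?_
      have := Finset.mem_range.1 hk
      rw [if_pos (by omega)]
      congr 2 <;> omega
    · refine Finset.sum_congr rfl fun k hk => ?_
      have := Finset.mem_range.1 hk
      rw [if_pos (by omega)]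
      congr 2 <;> omega

/-- The matrix of self-convolutions of `x` paired with the adjugate of its Hankel matrix. -/
theorem trace_convolution_mul_adjugate {R : Type*} [CommRing R] (x : ℕ → R) {m : ℕ} (hm : m ≤ 1)
    (n : ℕ) :
    (Matrix.of (fun i j : Fin (n + 1) =>
        ∑ a ∈ Finset.range (i.val + j.val + m + 1), x a * x (i.val + j.val + m - a)) *
      (Matrix.of fun i j : Fin (n + 1) => x (i.val + j.val + m)).adjugate).trace =
      (2 * n + 1 + m) * x 0 * (Matrix.of fun i j : Fin (n + 1) => x (i.val + j.val + m)).det := by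
  set M : Matrix (Fin (n + 1)) (Fin (n + 1)) R := Matrix.of fun i j => x (i.val + j.val + m)
    with hM
  let L : Matrix (Fin (n + 1)) (Fin (n + 1)) R :=
    Matrix.of fun i k => if k.val ≤ i.val then x (i.val - k.val) else 0
  let U : Matrix (Fin (n + 1)) (Fin (n + 1)) R := Matrix.of fun k j =>
    if k.val ≤ j.val then (if 1 ≤ k.val + m then x (j.val - k.val) else 0) else 0
  have hS : Matrix.of (fun i j : Fin (n + 1) =>
      ∑ a ∈ Finset.range (i.val + j.val + m + 1), x a * x (i.val + j.val + m - a)) =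
      L * M + M * U := by
    ext i j
    simp only [hM, L, U, Matrix.add_apply, Matrix.mul_apply, Matrix.of_apply, ite_mul, mul_ite,
      zero_mul, mul_zero]
    rw [sum_convolution_split x hm, sum_fin_ite_le i.2 fun k => x (i - k) * x (k + j + m),
      sum_fin_ite_le j.2 fun k => if 1 ≤ k + m then x (i + k + m) * x (j - k) else 0]
    simp only [mul_ite, mul_zero]
  have hL : L.trace = (n + 1) * x 0 := by simp [Matrix.trace, L]
  have hU : U.trace = (n + m) * x 0 := by
    simp only [Matrix.trace, U, Matrix.diag_apply, Matrix.of_apply, le_refl, if_true, Nat.sub_self]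
    interval_cases m
    · simp [Fin.sum_univ_succ]
    · simp
  rw [hS, add_mul, Matrix.trace_add, mul_assoc L, Matrix.mul_adjugate,
    Matrix.trace_mul_comm (M * U), ← mul_assoc, Matrix.adjugate_mul]
  simp only [Matrix.mul_smul, Matrix.smul_mul, mul_one, one_mul, Matrix.trace_smul, hL, hU,
    smul_eq_mul]
  ring

theorem trace_shift_mul_adjugate (c : ℕ → ℝ → ℝ) (m n : ℕ) (t : ℝ) :
    (Matrix.of (fun i j : Fin (n + 1) => c (i.val + j.val + m + 1) t) *
      (Matrix.of fun i j : Fin (n + 1) => c (i.val + j.val + m) t).adjugate).trace =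
      Gf c m (n + 1) t := by
  rw [← Matrix.sum_det_updateRow, Finset.sum_eq_single (Fin.last n)]
  · rw [Gf, if_neg n.succ_ne_zero]
    congr 1
    ext i j
    rcases eq_or_ne i (Fin.last n) with rfl | hi
    · simp only [Matrix.updateRow_self, Matrix.of_apply, Fin.val_last, Nat.add_sub_cancel, if_true]
      congr 1
      omega
    · have : i.val ≠ n := fun h => hi (Fin.ext h)
      simp [Matrix.updateRow_ne hi, this]
  · intro k _ hk
    have hk' : k.val < n := Fin.val_lt_last hk
    refine Matrix.det_zero_of_row_eq (i := k) (j := ⟨k + 1, by omega⟩) (by simp [Fin.ext_iff]) ?_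
    rw [Matrix.updateRow_self, Matrix.updateRow_ne (by simp [Fin.ext_iff])]
    ext j
    simp only [Matrix.of_apply]
    congr 1
    omega
  · simp

theorem hasDerivAt_Hf {c : ℕ → ℝ → ℝ} {u₀ : ℝ → ℝ} {t : ℝ} (hc0 : c 0 t ≠ 0)
    (hc : ∀ j, HasDerivAt (c j)
      (c (j + 1) t - u₀ t / c 0 t * ∑ i ∈ Finset.range (j + 1), c i t * c (j - i) t) t)
    {m : ℕ} (hm : m ≤ 1) (n : ℕ) :
    HasDerivAt (Hf c m (n + 1))
      (Gf c m (n + 1) t - (2 * n + 1 + m) * u₀ t * Hf c m (n + 1) t) t := by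
  let M : ℝ → Matrix (Fin (n + 1)) (Fin (n + 1)) ℝ :=
    fun s => Matrix.of fun i j => c (i.val + j.val + m) s
  let W : Matrix (Fin (n + 1)) (Fin (n + 1)) ℝ := Matrix.of fun i j => c (i.val + j.val + m + 1) t
  let S : Matrix (Fin (n + 1)) (Fin (n + 1)) ℝ := Matrix.of fun i j =>
    ∑ a ∈ Finset.range (i.val + j.val + m + 1), c a t * c (i.val + j.val + m - a) t
  have h : HasDerivAt (fun s => (M s).det) ((W - (u₀ t / c 0 t) • S) * (M t).adjugate).trace t :=
    HasDerivAt.matrix_det fun i j => hc (i.val + j.val + m)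
  have hS : (S * (M t).adjugate).trace = (2 * n + 1 + m) * c 0 t * (M t).det :=
    trace_convolution_mul_adjugate (fun j => c j t) hm n
  have hW : (W * (M t).adjugate).trace = Gf c m (n + 1) t := trace_shift_mul_adjugate c m n t
  rw [sub_mul, Matrix.trace_sub, hW, Matrix.smul_mul, Matrix.trace_smul, hS] at h
  convert! h using 1
  rw [smul_eq_mul, show Hf c m (n + 1) t = (M t).det from rfl]
  field_simp

theorem Gf_mul_Hf_sub_Gf_mul_Hf_eq (c : ℕ → ℝ → ℝ) (k : ℕ) (t : ℝ) :
    Gf c 1 (k + 1) t * Hf c 0 (k + 1) t - Gf c 0 (k + 1) t * Hf c 1 (k + 1) t =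
      Hf c 0 (k + 2) t * Hf c 1 k t := by
  let M : Matrix (Fin (k + 2)) (Fin (k + 2)) ℝ := Matrix.of fun i j => c (i.val + j.val + 0) t
  let p : Fin (k + 2) := (Fin.last k).castSucc
  have hp : p ≠ Fin.last (k + 1) := (Fin.castSucc_lt_last _).ne
  have key := M.det_mul_det_updateRow_updateRow hp (Pi.single 0 1) (Pi.single (Fin.last (k + 1)) 1)
  have hpval (r : Fin (k + 1)) : (p.succAbove r).val = if r.val = k then k + 1 else r.val := by
    refine Fin.lastCases ?_ (fun r => ?_) r
    · simp [p]
    · simp [p, r.2.ne]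
  have h₁ : (M.updateRow p (Pi.single 0 1)).det = (-1) ^ k * Gf c 1 (k + 1) t := by
    rw [Matrix.det_updateRow_single, Gf, if_neg k.succ_ne_zero]
    congr 2
    ext i j
    simp only [M, Matrix.submatrix_apply, Matrix.of_apply, hpval, Fin.zero_succAbove, Fin.val_succ,
      Nat.add_sub_cancel]
    split_ifs <;> congr 1
    omega
  have h₂ : (M.updateRow (Fin.last (k + 1)) (Pi.single (Fin.last (k + 1)) 1)).det =
      Hf c 0 (k + 1) t := by
    rw [Matrix.det_updateRow_single, Even.neg_pow ⟨_, rfl⟩, one_pow, one_mul, Hf,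
      Fin.succAbove_last]
    rfl
  have h₃ : (M.updateRow (Fin.last (k + 1)) (Pi.single 0 1)).det =
      (-1) ^ (k + 1) * Hf c 1 (k + 1) t := by
    rw [Matrix.det_updateRow_single, Hf, Fin.succAbove_last]
    rfl
  have h₄ : (M.updateRow p (Pi.single (Fin.last (k + 1)) 1)).det = -Gf c 0 (k + 1) t := by
    rw [Matrix.det_updateRow_single, Gf, if_neg k.succ_ne_zero,
      Odd.neg_pow ⟨k, by simp [p]; ring⟩, one_pow, neg_one_mul]
    congr 2
    ext i j
    simp only [M, Matrix.submatrix_apply, Matrix.of_apply, hpval, Fin.succAbove_last,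
      Fin.val_castSucc, Nat.add_sub_cancel]
    split_ifs <;> congr 1
    omega
  have h₅ : ((M.updateRow p (Pi.single 0 1)).updateRow (Fin.last (k + 1))
      (Pi.single (Fin.last (k + 1)) 1)).det = (-1) ^ k * Hf c 1 k t := by
    have h : (M.updateRow p (Pi.single 0 1)).submatrix Fin.castSucc Fin.castSucc =
        (M.submatrix Fin.castSucc Fin.castSucc).updateRow (Fin.last k) (Pi.single 0 1) := by
      ext i j
      refine Fin.lastCases ?_ (fun i => ?_) i
      · change M.updateRow p (Pi.single 0 1) p j.castSucc = _
        rw [Matrix.updateRow_self, Matrix.updateRow_self, Pi.single_apply, Pi.single_apply]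
        simp only [Fin.castSucc_eq_zero_iff]
      · have hi := (Fin.castSucc_lt_last i).ne
        rw [Matrix.submatrix_apply, Matrix.updateRow_ne (by simp [p]),
          Matrix.updateRow_ne hi, Matrix.submatrix_apply]
    rw [Matrix.det_updateRow_single, Even.neg_pow ⟨_, rfl⟩, one_pow, one_mul, Fin.succAbove_last,
      h, Matrix.det_updateRow_single, Hf, Fin.succAbove_last]
    rfl
  rw [h₁, h₂, h₃, h₄, h₅] at key
  change Hf c 0 (k + 2) t * _ = _ at key
  refine mul_left_cancel₀ (pow_ne_zero k (neg_ne_zero.2 one_ne_zero) : (-1 : ℝ) ^ k ≠ 0) ?_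
  linear_combination -key

theorem Gf_mul_Hf_sub_Gf_mul_Hf_succ_eq (c : ℕ → ℝ → ℝ) (k : ℕ) (t : ℝ) :
    Gf c 0 (k + 2) t * Hf c 1 (k + 1) t - Gf c 1 (k + 1) t * Hf c 0 (k + 2) t =
      Hf c 0 (k + 1) t * Hf c 1 (k + 2) t := by
  let M : Matrix (Fin (k + 2)) (Fin (k + 2)) ℝ := Matrix.of fun i j => c (i.val + j.val + 0) t
  let v : Fin (k + 2) → ℝ := fun j => c (k + 2 + j.val) t
  have key := M.det_mul_det_updateRow_updateRow (Fin.last_pos (n := k)).ne v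
    (Pi.single (Fin.last (k + 1)) 1)
  have h₁ : (M.updateRow 0 v).det = (-1) ^ (k + 1) * Hf c 1 (k + 2) t := by
    have h : M.updateRow 0 v = Matrix.of (Fin.cons v fun (i : Fin (k + 1)) (j : Fin (k + 2)) =>
        c (i.val + j.val + 1) t) := by
      ext i j
      refine Fin.cases ?_ (fun i => ?_) i
      · simp
      · simp [M, add_right_comm]
    rw [h, Matrix.det_cons_eq_det_snoc, Hf]
    congr 3
    ext i j
    refine Fin.lastCases ?_ (fun i => ?_) i
    · simp [v, add_right_comm]
    · simp
  have h₂ : (M.updateRow (Fin.last (k + 1)) (Pi.single (Fin.last (k + 1)) 1)).det =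
      Hf c 0 (k + 1) t := by
    rw [Matrix.det_updateRow_single, Even.neg_pow ⟨_, rfl⟩, one_pow, one_mul, Hf,
      Fin.succAbove_last]
    rfl
  have h₃ : (M.updateRow (Fin.last (k + 1)) v).det = Gf c 0 (k + 2) t := by
    rw [Gf, if_neg (by omega)]
    congr 1
    ext i j
    refine Fin.lastCases ?_ (fun i => ?_) i
    · simp [v]
    · simp [M, (Fin.castSucc_lt_last i).ne, i.2.ne]
  have h₄ : (M.updateRow 0 (Pi.single (Fin.last (k + 1)) 1)).det =
      (-1) ^ (k + 1) * Hf c 1 (k + 1) t := by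
    rw [Matrix.det_updateRow_single, Hf, Fin.succAbove_last, Fin.val_zero, zero_add]
    congr 2
    ext i j
    simp [M, add_right_comm]
  have h₅ : ((M.updateRow 0 v).updateRow (Fin.last (k + 1))
      (Pi.single (Fin.last (k + 1)) 1)).det = (-1) ^ k * Gf c 1 (k + 1) t := by
    rw [Matrix.det_updateRow_single]
    have h : ((M.updateRow 0 v).submatrix (Fin.last (k + 1)).succAbove
        (Fin.last (k + 1)).succAbove) = Matrix.of (Fin.cons (fun j : Fin (k + 1) =>
          c (k + 2 + j.val) t) fun (i : Fin k) (j : Fin (k + 1)) => c (i.val + j.val + 1) t) := by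
      ext i j
      refine Fin.cases ?_ (fun i => ?_) i
      · simp [v]
      · simp [M, add_right_comm]
    rw [h, Matrix.det_cons_eq_det_snoc, Gf, if_neg k.succ_ne_zero]
    simp only [Fin.val_last, Even.neg_pow ⟨k + 1, rfl⟩, one_pow, one_mul]
    congr 3
    ext i j
    refine Fin.lastCases ?_ (fun i => ?_) i
    · simp [add_comm, add_left_comm]
    · simp [i.2.ne]
  rw [h₁, h₂, h₃, h₄, h₅] at key
  change Hf c 0 (k + 2) t * _ = _ at key
  refine mul_left_cancel₀ (pow_ne_zero k (neg_ne_zero.2 one_ne_zero) : (-1 : ℝ) ^ k ≠ 0) ?_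
  linear_combination -key

/-- Under the Riccati system `c_j' = c_{j+1} − (u₀/c₀) Σ_{i=0}^{j} c_i c_{j−i}`,
the Hirota bilinear relations
`(H⁰_{n+1})' H¹_n − H⁰_{n+1} (H¹_n)' = H⁰_n H¹_{n+1} − u₀ H⁰_{n+1} H¹_n` and
`H⁰_n (H¹_n)' − (H⁰_n)' H¹_n = H⁰_{n+1} H¹_{n-1} − u₀ H⁰_n H¹_n` hold for `n ≥ 1`. -/
theorem bilinear_volterra (c : ℕ → ℝ → ℝ) (u₀ : ℝ → ℝ)
    (hc0 : ∀ t, c 0 t ≠ 0)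
    (hc : ∀ j t, HasDerivAt (c j)
      (c (j + 1) t - u₀ t / c 0 t * ∑ i ∈ Finset.range (j + 1), c i t * c (j - i) t) t)
    (n : ℕ) (hn : 1 ≤ n) (t : ℝ) :
    deriv (Hf c 0 (n + 1)) t * Hf c 1 n t - Hf c 0 (n + 1) t * deriv (Hf c 1 n) t =
        Hf c 0 n t * Hf c 1 (n + 1) t - u₀ t * Hf c 0 (n + 1) t * Hf c 1 n t ∧
      Hf c 0 n t * deriv (Hf c 1 n) t - deriv (Hf c 0 n) t * Hf c 1 n t =
        Hf c 0 (n + 1) t * Hf c 1 (n - 1) t - u₀ t * Hf c 0 n t * Hf c 1 n t := by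
  obtain ⟨k, rfl⟩ : ∃ k, n = k + 1 := ⟨n - 1, by omega⟩
  have hder {m : ℕ} (hm : m ≤ 1) (n : ℕ) := (hasDerivAt_Hf (hc0 t) (hc · t) hm n).deriv
  rw [hder le_rfl, hder zero_le_one, hder zero_le_one, Nat.add_sub_cancel]
  push_cast
  constructor
  · linear_combination Gf_mul_Hf_sub_Gf_mul_Hf_succ_eq c k t
  · linear_combination Gf_mul_Hf_sub_Gf_mul_Hf_eq c k t
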